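/- Let (Ω, 𝔄, μ) be a measure space with finite measure μ, let 𝕂 be ℝ or ℂ, let p, q ∈ (1, ∞) and let q' ∈ (1, ∞) satisfy 1/q + 1/q' = 1. Suppose k : Ω × Ω → 𝕂^{d×n} is μ⊗μ-measurable and ∫_Ω (∫_Ω |k(x,y)|^{q'} dμ(y))^{p/q'} dμ(x) < ∞ (Hille–Tamarkin condition). Then the bounded linear operator 𝒦 : L^q(Ω, 𝕂^n) → L^p(Ω, 𝕂^d), (𝒦u)(x) := ∫_Ω k(x,y) u(y) dμ(y), is a compact operator, i.e. the image under 𝒦 of the unit ball of L^q(Ω, 𝕂^n) is relatively compact in L^p(Ω, 𝕂^d). -/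

import Mathlib

open MeasureTheory ENNReal




namespace HT
open Filter Topology

lemma add_rpow_le' (a b : ℝ≥0∞) {s : ℝ} (hs : 0 ≤ s) :
    (a + b) ^ s ≤ 2 ^ s * (a ^ s + b ^ s) := by
  have h1 : a + b ≤ 2 * max a b := by
    rw [two_mul]; exact add_le_add (le_max_left _ _) (le_max_right _ _)
  refine (ENNReal.rpow_le_rpow h1 hs).trans ?_
  rw [ENNReal.mul_rpow_of_nonneg _ _ hs]
  gcongr
  rcases le_total a b with h | h
  · rw [max_eq_right h]; exact le_add_self
  · rw [max_eq_left h]; exact le_self_add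

variable {Ω : Type*} [MeasurableSpace Ω]

/-- The mixed (Hille–Tamarkin) functional. -/
noncomputable def M {G : Type*} [NormedAddCommGroup G] (μ : Measure Ω) (p q' : ℝ)
    (h : Ω × Ω → G) : ℝ≥0∞ :=
  ∫⁻ x, (∫⁻ y, ‖h (x, y)‖ₑ ^ q' ∂μ) ^ (p / q') ∂μ

section
variable {G : Type*} [NormedAddCommGroup G] (μ : Measure Ω) [IsFiniteMeasure μ] {p q' : ℝ}

lemma meas_inner {h : Ω × Ω → G} (hh : StronglyMeasurable h) :
    Measurable fun x => (∫⁻ y, ‖h (x, y)‖ₑ ^ q' ∂μ) ^ (p / q') := by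
  refine Measurable.pow_const ?_ _
  exact Measurable.lintegral_prod_right' (f := fun z : Ω × Ω => ‖h z‖ₑ ^ q')
    (hh.enorm.pow_const _)

lemma meas_slice {h : Ω × Ω → G} (hh : StronglyMeasurable h) (x : Ω) :
    Measurable fun y => ‖h (x, y)‖ₑ ^ q' :=
  (hh.enorm.pow_const q').comp measurable_prodMk_left

lemma M_add_le (hp : 1 < p) (hq' : 1 < q') : ∃ K : ℝ≥0∞, K ≠ ⊤ ∧
    ∀ a b : Ω × Ω → G, StronglyMeasurable a → StronglyMeasurable b →
      M μ p q' (a + b) ≤ K * (M μ p q' a + M μ p q' b) := by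
  have hq0 : 0 ≤ q' := by linarith
  have hs : 0 ≤ p / q' := by positivity
  refine ⟨(2 ^ q') ^ (p / q') * 2 ^ (p / q'), ?_, ?_⟩
  · exact ENNReal.mul_ne_top (ENNReal.rpow_ne_top_of_nonneg hs
      (ENNReal.rpow_ne_top_of_nonneg hq0 (by simp))) (ENNReal.rpow_ne_top_of_nonneg hs (by simp))
  intro a b ha hb
  unfold M
  rw [← lintegral_add_left (meas_inner μ ha), ← lintegral_const_mul]
  swap
  · exact (meas_inner μ ha).add (meas_inner μ hb)
  refine lintegral_mono fun x => ?_
  have h1 : ∫⁻ y, ‖(a + b) (x, y)‖ₑ ^ q' ∂μ ≤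
      2 ^ q' * (∫⁻ y, ‖a (x, y)‖ₑ ^ q' ∂μ + ∫⁻ y, ‖b (x, y)‖ₑ ^ q' ∂μ) := by
    rw [← lintegral_add_left (meas_slice ha x), ← lintegral_const_mul]
    swap
    · exact (meas_slice ha x).add (meas_slice hb x)
    refine lintegral_mono fun y => ?_
    exact (ENNReal.rpow_le_rpow (enorm_add_le _ _) hq0).trans (add_rpow_le' _ _ hq0)
  refine (ENNReal.rpow_le_rpow h1 hs).trans ?_
  rw [ENNReal.mul_rpow_of_nonneg _ _ hs, mul_assoc]
  gcongr
  exact add_rpow_le' _ _ hs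

lemma M_tendsto (hp : 1 < p) (hq' : 1 < q') {b : Ω × Ω → ℝ}
    (hbM : M μ p q' b ≠ ⊤) (hb : StronglyMeasurable b)
    {h : ℕ → Ω × Ω → G} (hh : ∀ m, StronglyMeasurable (h m))
    (hle : ∀ m z, ‖h m z‖ ≤ ‖b z‖)
    (hlim : ∀ z, Tendsto (fun m => h m z) atTop (𝓝 0)) :
    Tendsto (fun m => M μ p q' (h m)) atTop (𝓝 0) := by
  have hq0 : 0 < q' := by linarith
  have hs : 0 < p / q' := by positivity
  have hle' : ∀ m z, ‖h m z‖ₑ ≤ ‖b z‖ₑ := fun m z => enorm_le_iff_norm_le.2 (hle m z)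
  have hfin := ae_lt_top (meas_inner μ hb) hbM
  have := tendsto_lintegral_of_dominated_convergence (μ := μ)
    (F := fun m x => (∫⁻ y, ‖h m (x, y)‖ₑ ^ q' ∂μ) ^ (p / q')) (f := fun _ => 0)
    (fun x => (∫⁻ y, ‖b (x, y)‖ₑ ^ q' ∂μ) ^ (p / q'))
    (fun m => meas_inner μ (hh m))
    (fun m => Eventually.of_forall fun x => by
      dsimp only
      gcongr
      exact hle' m _) hbM ?_
  · simpa [M] using this
  filter_upwards [hfin] with x hx
  have hx' : ∫⁻ y, ‖b (x, y)‖ₑ ^ q' ∂μ ≠ ⊤ := by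
    intro h0
    rw [h0, ENNReal.top_rpow_of_pos hs] at hx
    exact lt_irrefl _ hx
  have h2 := tendsto_lintegral_of_dominated_convergence (μ := μ)
    (F := fun m y => ‖h m (x, y)‖ₑ ^ q') (f := fun _ => 0)
    (fun y => ‖b (x, y)‖ₑ ^ q') (fun m => meas_slice (hh m) x)
    (fun m => Eventually.of_forall fun y => by
      dsimp only
      gcongr
      exact hle' m _) hx' (Eventually.of_forall fun y => by
        have h3 := (hlim (x, y)).enorm
        have h4 := h3.ennrpow_const q'
        simpa [ENNReal.zero_rpow_of_pos hq0] using h4)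
  have h5 := h2.ennrpow_const (p / q')
  simpa [ENNReal.zero_rpow_of_pos hs] using h5

lemma M_const (hp : 1 < p) (hq' : 1 < q') (c : ℝ) :
    M μ p q' (fun _ : Ω × Ω => c) ≠ ⊤ := by
  have hq0 : 0 ≤ q' := by linarith
  have hs : 0 ≤ p / q' := by positivity
  simp only [M, lintegral_const]
  refine ENNReal.mul_ne_top (ENNReal.rpow_ne_top_of_nonneg hs (ENNReal.mul_ne_top
    (ENNReal.rpow_ne_top_of_nonneg hq0 (by simp)) (measure_ne_top _ _))) (measure_ne_top _ _)

end

section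
variable {𝕂 : Type*} [RCLike 𝕂] {E F : Type*}
  [NormedAddCommGroup E] [NormedSpace 𝕂 E] [NormedSpace ℝ E] [FiniteDimensional 𝕂 E]
  [NormedAddCommGroup F] [NormedSpace 𝕂 F] [NormedSpace ℝ F] [FiniteDimensional 𝕂 F]
  [IsScalarTower ℝ 𝕂 E] [IsScalarTower ℝ 𝕂 F] [CompleteSpace E] [CompleteSpace F]
  (μ : Measure Ω) [IsFiniteMeasure μ] (p q q' : ℝ)
  [Fact (1 ≤ ENNReal.ofReal p)] [Fact (1 ≤ ENNReal.ofReal q)]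

/-- Bounded kernels generating a compact operator. -/
def P (g : Ω × Ω → E →L[𝕂] F) : Prop :=
  StronglyMeasurable g ∧ (∃ C : ℝ, ∀ z, ‖g z‖ ≤ C) ∧
  ∃ S : Lp E (ENNReal.ofReal q) μ →L[𝕂] Lp F (ENNReal.ofReal p) μ, IsCompactOperator S ∧
    ∀ u, (S u : Ω → F) =ᵐ[μ] fun x => ∫ y, g (x, y) (u y) ∂μ

/-- Kernels approximable by good ones. -/
def Q (h : Ω × Ω → E →L[𝕂] F) : Prop :=
  StronglyMeasurable h ∧ ∀ ε : ℝ≥0∞, ε ≠ 0 → ∃ g, P μ p q g ∧ M μ p q' (h - g) ≤ ε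

variable {p q q'}

lemma Lp_int (u : Lp E (ENNReal.ofReal q) μ) : Integrable u μ :=
  (Lp.memLp u).integrable (Fact.out)

lemma slice_meas {g : Ω × Ω → E →L[𝕂] F} (hg : StronglyMeasurable g) (x : Ω)
    (u : Lp E (ENNReal.ofReal q) μ) :
    AEStronglyMeasurable (fun y => g (x, y) (u y)) μ := by
  have h1 : StronglyMeasurable fun y => g (x, y) := hg.comp_measurable measurable_prodMk_left
  exact (ContinuousLinearMap.apply 𝕂 F).flip.aestronglyMeasurable_comp₂
      h1.aestronglyMeasurable (Lp.aestronglyMeasurable u)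

lemma P_int {g : Ω × Ω → E →L[𝕂] F} (hg : StronglyMeasurable g) (hC : ∃ C : ℝ, ∀ z, ‖g z‖ ≤ C)
    (x : Ω) (u : Lp E (ENNReal.ofReal q) μ) :
    Integrable (fun y => g (x, y) (u y)) μ := by
  obtain ⟨C, hC⟩ := hC
  refine ((Lp_int μ u).norm.const_mul C).mono' (slice_meas μ hg x u)
    (Eventually.of_forall fun y => ?_)
  exact ((g (x, y)).le_opNorm _).trans (by gcongr; exact hC _)

lemma P_add {g₁ g₂ : Ω × Ω → E →L[𝕂] F} (h₁ : P μ p q g₁) (h₂ : P μ p q g₂) :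
    P μ p q (g₁ + g₂) := by
  obtain ⟨m₁, c₁, S₁, k₁, e₁⟩ := h₁
  obtain ⟨m₂, c₂, S₂, k₂, e₂⟩ := h₂
  refine ⟨m₁.add m₂, ?_, S₁ + S₂, ?_, fun u => ?_⟩
  · obtain ⟨C₁, c₁⟩ := c₁
    obtain ⟨C₂, c₂⟩ := c₂
    exact ⟨C₁ + C₂, fun z => (norm_add_le _ _).trans (add_le_add (c₁ z) (c₂ z))⟩
  · exact k₁.add k₂
  · have : (S₁ + S₂) u = S₁ u + S₂ u := rfl
    rw [this]
    filter_upwards [Lp.coeFn_add (S₁ u) (S₂ u), e₁ u, e₂ u] with x h h1 h2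
    rw [h, Pi.add_apply, h1, h2, ← integral_add (P_int μ m₁ c₁ x u) (P_int μ m₂ c₂ x u)]
    rfl

lemma P_zero : P μ p q (0 : Ω × Ω → E →L[𝕂] F) := by
  refine ⟨stronglyMeasurable_zero, ⟨0, fun z => by simp⟩, 0, isCompactOperator_zero, fun u => ?_⟩
  filter_upwards [Lp.coeFn_zero F (ENNReal.ofReal p) μ] with x hx
  simpa using hx

/-- integral over a set, as a continuous linear map. -/
lemma exists_intCLM {B : Set Ω} (hB : MeasurableSet B) :
    ∃ I : Lp E (ENNReal.ofReal q) μ →L[𝕂] E, ∀ u, I u = ∫ y in B, u y ∂μ := by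
  let I0 : Lp E (ENNReal.ofReal q) μ →ₗ[𝕂] E :=
    { toFun := fun u => ∫ y in B, u y ∂μ
      map_add' := fun u v => by
        rw [← integral_add (Lp_int μ u).integrableOn (Lp_int μ v).integrableOn]
        exact integral_congr_ae (ae_restrict_of_ae (Lp.coeFn_add u v))
      map_smul' := fun c u => by
        rw [RingHom.id_apply, ← integral_smul]
        exact integral_congr_ae (ae_restrict_of_ae (Lp.coeFn_smul c u)) }
  refine ⟨I0.mkContinuous (μ.real Set.univ ^ (1 - 1 / (ENNReal.ofReal q).toReal)) fun u => ?_,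
    fun u => rfl⟩
  have hu := Lp_int μ u
  have h1 : ‖I0 u‖ₑ ≤ eLpNorm u 1 μ := by
    rw [eLpNorm_one_eq_lintegral_enorm]
    exact (enorm_integral_le_lintegral_enorm _).trans (setLIntegral_le_lintegral _ _)
  have h2 := eLpNorm_le_eLpNorm_mul_rpow_measure_univ (μ := μ) (p := 1) (q := ENNReal.ofReal q)
    (Fact.out) (Lp.aestronglyMeasurable u)
  have h3 := h1.trans h2
  have h4 := ENNReal.toReal_mono ?_ h3
  · rw [ENNReal.toReal_mul, ← ENNReal.toReal_rpow] at h4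
    rw [Lp.norm_def, mul_comm]
    simpa [Measure.real] using h4
  · refine ENNReal.mul_ne_top (Lp.eLpNorm_ne_top u) (ENNReal.rpow_ne_top_of_nonneg ?_
      (measure_ne_top _ _))
    have h1q : 1 ≤ ENNReal.ofReal q := Fact.out
    have h5 : 1 ≤ (ENNReal.ofReal q).toReal := by
      have := ENNReal.toReal_mono ENNReal.ofReal_ne_top h1q
      simpa using this
    simp only [ENNReal.toReal_one, div_one, sub_nonneg]
    exact (div_le_one (by linarith)).2 h5

lemma P_rect {A B : Set Ω} (hA : MeasurableSet A) (hB : MeasurableSet B) (c : E →L[𝕂] F) :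
    P μ p q ((A ×ˢ B).indicator fun _ => c) := by
  refine ⟨stronglyMeasurable_const.indicator (hA.prod hB), ⟨‖c‖, fun z => norm_indicator_le_norm_self (fun _ => c) z⟩, ?_⟩
  obtain ⟨I, hI⟩ := exists_intCLM (𝕂 := 𝕂) (E := E) (q := q) μ hB
  let J0 : F →ₗ[𝕂] Lp F (ENNReal.ofReal p) μ :=
    { toFun := fun v => indicatorConstLp _ hA (measure_ne_top _ _) v
      map_add' := fun v w => indicatorConstLp_add.symm
      map_smul' := fun a v => by
        rw [RingHom.id_apply]
        simp_rw [indicatorConstLp, ← MemLp.toLp_const_smul, Set.indicator_const_smul]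
        rfl }
  let J : F →L[𝕂] Lp F (ENNReal.ofReal p) μ := J0.toContinuousLinearMap
  have : ProperSpace F := FiniteDimensional.proper 𝕂 F
  refine ⟨J ∘L (c ∘L I), (isCompactOperator_of_locallyCompactSpace_dom (c ∘L I)).clm_comp J,
    fun u => ?_⟩
  have h1 : (J ∘L (c ∘L I)) u = indicatorConstLp (ENNReal.ofReal p) hA (measure_ne_top _ _)
    (c (∫ y in B, u y ∂μ)) := by rw [← hI]; rfl
  rw [h1]
  filter_upwards [indicatorConstLp_coeFn (p := ENNReal.ofReal p) (hs := hA)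
    (hμs := measure_ne_top μ A) (c := c (∫ y in B, u y ∂μ))] with x hx
  rw [hx]
  by_cases hxA : x ∈ A
  · rw [Set.indicator_of_mem hxA, ← ContinuousLinearMap.integral_comp_comm _
      (Lp_int μ u).integrableOn, ← integral_indicator hB]
    congr 1 with y
    by_cases hy : y ∈ B <;> simp [hxA, hy]
  · simp [hxA]

variable (hp : 1 < p) (hq' : 1 < q')
include hp hq'

lemma Q_of_P {g : Ω × Ω → E →L[𝕂] F} (h : P μ p q g) : Q μ p q q' g := by
  refine ⟨h.1, fun ε _ => ⟨g, h, ?_⟩⟩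
  have hq0 : 0 < q' := by linarith
  have hs : 0 < p / q' := by positivity
  have h0 : ∀ z, ‖(g - g) z‖ₑ = 0 := fun z => by rw [Pi.sub_apply, sub_self]; exact enorm_zero (E := E →L[𝕂] F)
  simp only [M, h0]
  simp [ENNReal.zero_rpow_of_pos hq0, ENNReal.zero_rpow_of_pos hs]

lemma exists_delta {K ε : ℝ≥0∞} (hK : K ≠ ⊤) (hε : ε ≠ 0) :
    ∃ δ : ℝ≥0∞, δ ≠ 0 ∧ K * (δ + δ) ≤ ε := by
  refine ⟨ε / K / 2, ?_, ?_⟩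
  · simp [ENNReal.div_eq_zero_iff, hK, hε]
  · rw [ENNReal.add_halves]; exact ENNReal.mul_div_le

lemma Q_add {h₁ h₂ : Ω × Ω → E →L[𝕂] F} (H₁ : Q μ p q q' h₁) (H₂ : Q μ p q q' h₂) :
    Q μ p q q' (h₁ + h₂) := by
  refine ⟨H₁.1.add H₂.1, fun ε hε => ?_⟩
  obtain ⟨K, hK, hadd⟩ := M_add_le (G := E →L[𝕂] F) μ hp hq'
  obtain ⟨δ, hδ, hδε⟩ := exists_delta hp hq' hK hε
  obtain ⟨g₁, P₁, e₁⟩ := H₁.2 δ hδ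
  obtain ⟨g₂, P₂, e₂⟩ := H₂.2 δ hδ
  refine ⟨g₁ + g₂, P_add μ P₁ P₂, ?_⟩
  rw [add_sub_add_comm]
  refine (hadd _ _ (H₁.1.sub P₁.1) (H₂.1.sub P₂.1)).trans (le_trans ?_ hδε)
  gcongr

lemma Q_lim {h : Ω × Ω → E →L[𝕂] F} (hm : StronglyMeasurable h) {f : ℕ → Ω × Ω → E →L[𝕂] F}
    (hf : ∀ m, Q μ p q q' (f m)) (hlim : Tendsto (fun m => M μ p q' (h - f m)) atTop (𝓝 0)) :
    Q μ p q q' h := by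
  refine ⟨hm, fun ε hε => ?_⟩
  obtain ⟨K, hK, hadd⟩ := M_add_le (G := E →L[𝕂] F) μ hp hq'
  obtain ⟨δ, hδ, hδε⟩ := exists_delta hp hq' hK hε
  obtain ⟨m, hm'⟩ := (hlim.eventually (ge_mem_nhds (pos_iff_ne_zero.2 hδ))).exists
  obtain ⟨g, Pg, e⟩ := (hf m).2 δ hδ
  refine ⟨g, Pg, ?_⟩
  rw [← sub_add_sub_cancel h (f m) g]
  refine (hadd _ _ (hm.sub (hf m).1) ((hf m).1.sub Pg.1)).trans (le_trans ?_ hδε)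
  gcongr

lemma Q_set (s : Set (Ω × Ω)) (hs : MeasurableSet s) :
    ∀ c : E →L[𝕂] F, Q μ p q q' (s.indicator fun _ => c) := by
  induction s, hs using MeasurableSpace.induction_on_inter generateFrom_prod.symm
    isPiSystem_prod with
  | empty => intro c; simpa using! Q_of_P μ hp hq' (P_zero (𝕂 := 𝕂) μ)
  | basic t ht =>
    intro c
    obtain ⟨A, hA, B, hB, rfl⟩ := ht
    exact Q_of_P μ hp hq' (P_rect μ hA hB c)
  | compl t ht ih =>
    intro c
    have h1 : (tᶜ.indicator fun _ => c) = ((Set.univ ×ˢ Set.univ : Set (Ω × Ω)).indicator fun _ => c)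
        + t.indicator fun _ => -c := by
      ext1 z
      by_cases hz : z ∈ t <;> simp [hz]
    rw [h1]
    exact Q_add μ hp hq' (Q_of_P μ hp hq' (P_rect μ .univ .univ c)) (ih _)
  | iUnion f hd hf ih =>
    intro c
    have hfin : ∀ m : ℕ, Q μ p q q' ((⋃ i ∈ Finset.range m, f i).indicator fun _ => c) := by
      intro m
      induction m with
      | zero => simpa using! Q_of_P μ hp hq' (P_zero (𝕂 := 𝕂) μ)
      | succ m im =>
        have h2 : ((⋃ i ∈ Finset.range (m + 1), f i).indicator fun _ => c)
            = ((⋃ i ∈ Finset.range m, f i).indicator fun _ => c) + (f m).indicator fun _ => c := by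
          rw [Finset.range_add_one, Finset.set_biUnion_insert, Set.union_comm]
          refine Set.indicator_union_of_disjoint ?_ _
          simp only [Set.disjoint_iUnion_left]
          intro i hi
          exact hd (Finset.mem_range.1 hi).ne
        rw [h2]
        exact Q_add μ hp hq' im (ih m c)
    have hU : StronglyMeasurable ((⋃ i, f i).indicator fun _ => c) :=
      stronglyMeasurable_const.indicator (.iUnion hf)
    refine Q_lim μ hp hq' hU hfin ?_
    refine M_tendsto μ hp hq' (b := fun _ => ‖c‖) (M_const μ hp hq' _) stronglyMeasurable_const
      (fun m => hU.sub (hfin m).1) ?_ ?_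
    · intro m z
      rw [norm_norm, Pi.sub_apply]
      by_cases h1 : z ∈ ⋃ i ∈ Finset.range m, f i
      · have h2 : z ∈ ⋃ i, f i := by
          simp only [Set.mem_iUnion] at h1 ⊢
          obtain ⟨i, -, h⟩ := h1
          exact ⟨i, h⟩
        rw [Set.indicator_of_mem h1, Set.indicator_of_mem h2]; simp
      · rw [Set.indicator_of_notMem h1, sub_zero]
        exact norm_indicator_le_norm_self (fun _ => c) z
    · intro z
      refine tendsto_const_nhds.congr' ?_
      by_cases h2 : z ∈ ⋃ i, f i
      · obtain ⟨i, hi⟩ := Set.mem_iUnion.1 h2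
        filter_upwards [eventually_gt_atTop i] with m hm
        have h1 : z ∈ ⋃ i ∈ Finset.range m, f i := by
          simp only [Set.mem_iUnion, Finset.mem_range]
          exact ⟨i, hm, hi⟩
        rw [Pi.sub_apply, Set.indicator_of_mem h1, Set.indicator_of_mem h2, sub_self]
      · refine Eventually.of_forall fun m => ?_
        have h1 : z ∉ ⋃ i ∈ Finset.range m, f i := by
          simp only [Set.mem_iUnion] at h2 ⊢
          rintro ⟨i, -, h⟩
          exact h2 ⟨i, h⟩
        dsimp only
        rw [Pi.sub_apply, Set.indicator_of_notMem h1, Set.indicator_of_notMem h2, sub_self]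

lemma Q_simple (f : SimpleFunc (Ω × Ω) (E →L[𝕂] F)) : Q μ p q q' f := by
  induction f using SimpleFunc.induction with
  | const c hs =>
    have := Q_set (q := q) μ hp hq' _ hs c
    convert! this using 1
  | add hd h1 h2 =>
    rw [SimpleFunc.coe_add]
    exact Q_add μ hp hq' h1 h2

lemma Q_all {k : Ω × Ω → E →L[𝕂] F} (hk : StronglyMeasurable k) (hM : M μ p q' k ≠ ⊤) :
    Q μ p q q' k := by
  have := hk.separableSpace_range_union_singleton (b := 0)
  let f : ℕ → SimpleFunc (Ω × Ω) (E →L[𝕂] F) := fun m =>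
    SimpleFunc.approxOn k hk.measurable (Set.range k ∪ {0}) 0 (by simp) m
  refine Q_lim μ hp hq' hk (fun m => Q_simple μ hp hq' (f m)) ?_
  refine M_tendsto μ hp hq' (b := fun z => ‖k z‖) ?_ hk.norm
    (fun m => hk.sub (f m).stronglyMeasurable) ?_ ?_
  · simpa [M] using hM
  · intro m z
    have := SimpleFunc.edist_approxOn_le hk.measurable (s := Set.range k ∪ {0}) (y₀ := 0)
      (by simp) z m
    rw [edist_dist, edist_dist, ENNReal.ofReal_le_ofReal_iff dist_nonneg, dist_comm,
      dist_eq_norm, dist_zero_left] at this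
    rw [norm_norm]
    exact this
  · intro z
    have := SimpleFunc.tendsto_approxOn hk.measurable (s := Set.range k ∪ {0}) (y₀ := 0)
      (by simp) (x := z) (subset_closure (by simp))
    have h2 := this.const_sub (k z)
    rw [sub_self] at h2
    exact h2

/-- The operator bound. -/
lemma op_bound (hq : 1 < q) (hconj : q'.HolderConjugate q) {k g : Ω × Ω → E →L[𝕂] F}
    (hk : StronglyMeasurable k) (hM : M μ p q' k ≠ ⊤)
    (hg : StronglyMeasurable g) (hC : ∃ C : ℝ, ∀ z, ‖g z‖ ≤ C)
    (T S : Lp E (ENNReal.ofReal q) μ →L[𝕂] Lp F (ENNReal.ofReal p) μ)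
    (hT : ∀ u, (T u : Ω → F) =ᵐ[μ] fun x => ∫ y, k (x, y) (u y) ∂μ)
    (hS : ∀ u, (S u : Ω → F) =ᵐ[μ] fun x => ∫ y, g (x, y) (u y) ∂μ)
    (u : Lp E (ENNReal.ofReal q) μ) :
    ‖(T - S) u‖ₑ ≤ M μ p q' (k - g) ^ (1 / p) * ‖u‖ₑ := by
  have hp0 : 0 < p := by linarith
  have hq0 : 0 < q := by linarith
  have hq0' : 0 < q' := by linarith
  have hs : 0 < p / q' := by positivity
  have hnorm : (∫⁻ y, ‖u y‖ₑ ^ q ∂μ) ^ (1 / q) = ‖u‖ₑ := by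
    rw [Lp.enorm_def, eLpNorm_eq_lintegral_rpow_enorm_toReal (by simpa using hq0) (by simp),
      ENNReal.toReal_ofReal hq0.le]
  have holder : ∀ {h : Ω × Ω → E →L[𝕂] F}, StronglyMeasurable h → ∀ x,
      ∫⁻ y, ‖h (x, y) (u y)‖ₑ ∂μ ≤ (∫⁻ y, ‖h (x, y)‖ₑ ^ q' ∂μ) ^ (1 / q') * ‖u‖ₑ := by
    intro h hh x
    rw [← hnorm]
    refine le_trans (lintegral_mono fun y => ?_) (ENNReal.lintegral_mul_le_Lp_mul_Lq μ hconj
      (f := fun y => ‖h (x, y)‖ₑ) (g := fun y => ‖u y‖ₑ)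
      (hh.enorm.comp measurable_prodMk_left).aemeasurable
      (Lp.aestronglyMeasurable u).enorm)
    exact (h (x, y)).le_opENorm (u y)
  have hfin := ae_lt_top (meas_inner μ hk) hM
  rw [Lp.enorm_def, eLpNorm_eq_lintegral_rpow_enorm_toReal (by simpa using hp0) (by simp),
      ENNReal.toReal_ofReal hp0.le]
  have key : ∀ᵐ x ∂μ, ‖((T - S) u) x‖ₑ ^ p ≤
      (∫⁻ y, ‖(k - g) (x, y)‖ₑ ^ q' ∂μ) ^ (p / q') * ‖u‖ₑ ^ p := by
    have e : (T - S) u = T u - S u := rfl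
    rw [e]
    filter_upwards [hfin, hT u, hS u, Lp.coeFn_sub (T u) (S u)] with x hx h1 h2 h3
    have hx' : ∫⁻ y, ‖k (x, y)‖ₑ ^ q' ∂μ ≠ ⊤ := by
      intro h0
      rw [h0, ENNReal.top_rpow_of_pos hs] at hx
      exact lt_irrefl _ hx
    have hki : Integrable (fun y => k (x, y) (u y)) μ := by
      refine ⟨slice_meas μ hk x u, (holder hk x).trans_lt ?_⟩
      exact ENNReal.mul_lt_top (ENNReal.rpow_lt_top_of_nonneg (by positivity) hx') enorm_lt_top
    rw [h3, Pi.sub_apply, h1, h2, ← integral_sub hki (P_int μ hg hC x u)]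
    have h4 := (enorm_integral_le_lintegral_enorm (μ := μ)
      (fun y => k (x, y) (u y) - g (x, y) (u y))).trans (holder (hk.sub hg) x)
    refine (ENNReal.rpow_le_rpow h4 hp0.le).trans ?_
    rw [ENNReal.mul_rpow_of_nonneg _ _ hp0.le, ← ENNReal.rpow_mul, one_div_mul_eq_div]
  refine (ENNReal.rpow_le_rpow (lintegral_mono_ae key) (by positivity)).trans ?_
  rw [lintegral_mul_const _ (meas_inner μ (hk.sub hg)),
    ENNReal.mul_rpow_of_nonneg _ _ (by positivity), ← ENNReal.rpow_mul, mul_one_div_cancel hp0.ne',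
    ENNReal.rpow_one]
  rfl

lemma compact_of (hq : 1 < q) (hconj : q'.HolderConjugate q) {k : Ω × Ω → E →L[𝕂] F}
    (hk : StronglyMeasurable k) (hM : M μ p q' k ≠ ⊤)
    (T : Lp E (ENNReal.ofReal q) μ →L[𝕂] Lp F (ENNReal.ofReal p) μ)
    (hT : ∀ u, (T u : Ω → F) =ᵐ[μ] fun x => ∫ y, k (x, y) (u y) ∂μ) :
    IsCompactOperator T := by
  have hp0 : 0 < p := by linarith
  have hcl := isClosed_setOfPred_isCompactOperator (σ₁₂ := RingHom.id 𝕂)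
    (M₁ := Lp E (ENNReal.ofReal q) μ) (M₂ := Lp F (ENNReal.ofReal p) μ)
  have hmem : T ∈ closure {f : Lp E (ENNReal.ofReal q) μ →L[𝕂] Lp F (ENNReal.ofReal p) μ |
      IsCompactOperator f} := by
    rw [Metric.mem_closure_iff]
    intro ε hε
    obtain ⟨g, ⟨hg, hC, S, hSc, hS⟩, hle⟩ := (Q_all (q := q) μ hp hq' hk hM).2
      (ENNReal.ofReal (ε / 2) ^ p) (by
        simp only [ne_eq, ENNReal.rpow_eq_zero_iff, not_or, not_and]
        constructor
        · intro h0
          simp at h0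
          linarith
        · intro h0
          simp at h0)
    refine ⟨S, hSc, ?_⟩
    rw [dist_eq_norm]
    refine lt_of_le_of_lt ?_ (half_lt_self hε)
    refine ContinuousLinearMap.opNorm_le_bound _ (by positivity) fun u => ?_
    have hb := op_bound μ hp hq' hq hconj hk hM hg hC T S hT hS u
    have h1 : M μ p q' (k - g) ^ (1 / p) ≤ ENNReal.ofReal (ε / 2) := by
      refine (ENNReal.rpow_le_rpow hle (by positivity)).trans ?_
      rw [← ENNReal.rpow_mul, mul_one_div_cancel hp0.ne', ENNReal.rpow_one]
    have h2 := hb.trans (mul_le_mul_left h1 _)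
    have h3 := ENNReal.toReal_mono (ENNReal.mul_ne_top (by simp) (by simp)) h2
    rw [ENNReal.toReal_mul, ENNReal.toReal_ofReal (by positivity)] at h3
    simpa using h3
  rw [hcl.closure_eq] at hmem
  exact hmem

end
end HT

/-- compactness of the Fredholm integral operator under the
Hille–Tamarkin condition: the image of the unit ball of `L^q` under `𝒦` is
relatively compact in `L^p`. -/
theorem stmt_1 {𝕂 : Type*} [RCLike 𝕂] {Ω : Type*} [MeasurableSpace Ω]
    (μ : Measure Ω) [IsFiniteMeasure μ] (d n : ℕ)
    (p q q' : ℝ) (hp : 1 < p) (hq : 1 < q) (hq' : 1 < q')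
    (hconj : 1 / q + 1 / q' = 1)
    [Fact (1 ≤ ENNReal.ofReal p)] [Fact (1 ≤ ENNReal.ofReal q)]
    (k : Ω → Ω → EuclideanSpace 𝕂 (Fin n) →L[𝕂] EuclideanSpace 𝕂 (Fin d))
    (hkmeas : StronglyMeasurable (Function.uncurry k))
    (hHT : (∫⁻ x, (∫⁻ y, (‖k x y‖₊ : ℝ≥0∞) ^ q' ∂μ) ^ (p / q') ∂μ) ≠ ⊤)
    (T : Lp (EuclideanSpace 𝕂 (Fin n)) (ENNReal.ofReal q) μ →L[𝕂]
         Lp (EuclideanSpace 𝕂 (Fin d)) (ENNReal.ofReal p) μ)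
    (hT : ∀ u : Lp (EuclideanSpace 𝕂 (Fin n)) (ENNReal.ofReal q) μ,
      (T u : Ω → EuclideanSpace 𝕂 (Fin d)) =ᵐ[μ] fun x => ∫ y, k x y (u y) ∂μ) :
    IsCompact (closure (⇑T '' Metric.closedBall 0 1)) := by
  have hc : q'.HolderConjugate q := by
    refine Real.holderConjugate_iff.2 ⟨hq', ?_⟩
    rw [← one_div, ← one_div, add_comm]; exact hconj
  have hM : HT.M μ p q' (Function.uncurry k) ≠ ⊤ := hHT
  have h1 : IsCompactOperator T :=
    HT.compact_of (k := Function.uncurry k) μ hp hq' hq hc hkmeas hM T hT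
  exact IsCompactOperator.isCompact_closure_image_closedBall (f := T.toLinearMap) h1 1
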